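/- Assume that every zero of the Riemann zeta function ζ(s) with 0 < Re(s) < 1 has Re(s) = 1/2. Fix ε, ε' ∈ (0, 1/4). Then, as X → ∞, ∫_{(ε')} ∫_{(ε)} (ζ''/ζ)(1 + α + β) · Φ̃(1/2 + α) · Φ̃(1/2 + β) · X^{α+β} dα dβ = −2·C_Φ·log X − 2·C'_Φ + 2·γ₀·C_Φ + O(X^{−2/5}), where γ₀ is the Euler–Mascheroni constant. -/

import Mathlib

noncomputable section

open scoped Classical

open Complex Real Filter Asymptotics MeasureTheory

/-- `C_Φ = 4π² ∫₀^∞ Φ(x)² dx`. -/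
def CPhi (Φ : ℝ → ℝ) : ℝ := 4 * π ^ 2 * ∫ x in Set.Ioi (0:ℝ), Φ x ^ 2

/-- `C'_Φ = 4π² ∫₀^∞ (log x) Φ(x)² dx`. -/
def CPhi' (Φ : ℝ → ℝ) : ℝ := 4 * π ^ 2 * ∫ x in Set.Ioi (0:ℝ), Real.log x * Φ x ^ 2

/-- The Mellin transform `Φ̃(s) = ∫₀^∞ Φ(x) x^{s-1} dx` at a complex point `s`. -/
def mellinC (Φ : ℝ → ℝ) (s : ℂ) : ℂ := ∫ x in Set.Ioi (0:ℝ), (Φ x : ℂ) * (x : ℂ) ^ (s - 1)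

/-- The vertical-line integral `∫_{(c)} g(s) ds = i ∫_ℝ g(c + it) dt`. -/
def vertInt (g : ℂ → ℂ) (c : ℝ) : ℂ := Complex.I * ∫ t : ℝ, g ((c : ℂ) + (t : ℂ) * Complex.I)

/-- On a disc where `f` has no zeros and `‖f‖ ≤ exp M * ‖f c‖`, the logarithmic derivative of `f`
and its derivative are bounded by multiples of `M` on smaller discs. -/
theorem norm_logDeriv_le_of_norm_le {f : ℂ → ℂ} {c : ℂ} {R ρ M : ℝ} (hρ : 0 < ρ) (hρR : 3 * ρ < R)
    (hM : 0 < M) (hf : DifferentiableOn ℂ f (Metric.ball c R))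
    (hf0 : ∀ z ∈ Metric.ball c R, f z ≠ 0)
    (hb : ∀ z ∈ Metric.ball c R, ‖f z‖ ≤ Real.exp M * ‖f c‖) :
    (∀ z ∈ Metric.closedBall c (R - 2 * ρ), ‖deriv f z / f z‖ ≤ 2 * M * R / ρ / ρ) ∧
    (∀ z ∈ Metric.closedBall c (R - 3 * ρ),
      ‖deriv (fun w => deriv f w / f w) z‖ ≤ 2 * M * R / ρ / ρ / ρ) := by
  have hR : 0 < R := by linarith
  have hcb : c ∈ Metric.ball c R := Metric.mem_ball_self hR
  have hL : DifferentiableOn ℂ (fun w => deriv f w / f w) (Metric.ball c R) :=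
    (hf.deriv Metric.isOpen_ball).div hf hf0
  obtain ⟨g, hgc, hg⟩ := hL.isExactOn_ball.with_val_at c 0
  have hexp : ∀ z ∈ Metric.ball c R, f z = f c * Complex.exp (g z) := by
    have hd : ∀ z ∈ Metric.ball c R,
        HasDerivAt (fun w => f w * Complex.exp (-g w)) 0 z := by
      intro z hz
      have h1 := (hf.differentiableAt (Metric.isOpen_ball.mem_nhds hz)).hasDerivAt
      have h2 := (hg z hz).neg.cexp
      convert! h1.mul h2 using 1
      have := hf0 z hz
      field_simp
      ring
    intro z hz
    have hconst := (convex_ball c R).is_const_of_fderivWithin_eq_zero (𝕜 := ℂ)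
      (f := fun w => f w * Complex.exp (-g w))
      (fun w hw => (hd w hw).differentiableAt.differentiableWithinAt)
      (fun w hw => by
        rw [fderivWithin_of_isOpen Metric.isOpen_ball hw]
        ext
        simp [(hd w hw).deriv]) hz hcb
    simp only [hgc, neg_zero, Complex.exp_zero, mul_one] at hconst
    rw [← hconst, mul_assoc, ← Complex.exp_add]
    simp
  have hre : ∀ z ∈ Metric.ball c R, (g z).re ≤ M := by
    intro z hz
    have h1 := hb z hz
    rw [hexp z hz, norm_mul, Complex.norm_exp, mul_comm] at h1
    have h2 : 0 < ‖f c‖ := norm_pos_iff.mpr (hf0 c hcb)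
    exact Real.exp_le_exp.mp (le_of_mul_le_mul_right h1 h2)
  have hgb : ∀ z ∈ Metric.closedBall c (R - ρ), ‖g z‖ ≤ 2 * M * R / ρ := by
    intro z hz
    rw [mem_closedBall_iff_norm] at hz
    have hmem : ∀ w ∈ Metric.ball (0 : ℂ) R, c + w ∈ Metric.ball c R := by
      intro w hw
      simpa [mem_ball_iff_norm] using hw
    have key := Complex.borelCaratheodory_zero (f := fun w => g (c + w)) (R := R) (z := z - c) hM
      (fun w hw => by
        have := (hg (c + w) (hmem w hw)).differentiableAt
        exact (this.comp w (by fun_prop)).differentiableWithinAt)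
      (fun w hw => hre _ (hmem w hw)) hR (by rw [mem_ball_zero_iff]; linarith) (by simpa using hgc)
    rw [add_sub_cancel] at key
    refine key.trans ?_
    gcongr <;> linarith
  have hsub : ∀ {r : ℝ}, r < R → Metric.closedBall c r ⊆ Metric.ball c R :=
    fun h => Metric.closedBall_subset_ball h
  have hcauchy : ∀ {h : ℂ → ℂ} {r B : ℝ}, DifferentiableOn ℂ h (Metric.ball c R) → r + ρ < R →
      (∀ z ∈ Metric.closedBall c (r + ρ), ‖h z‖ ≤ B) →
      ∀ z ∈ Metric.closedBall c r, ‖deriv h z‖ ≤ B / ρ := by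
    intro h r B hh hr hB z hz
    have hs : Metric.closedBall z ρ ⊆ Metric.closedBall c (r + ρ) := by
      intro w hw
      rw [Metric.mem_closedBall] at *
      linarith [dist_triangle w z c]
    refine Complex.norm_deriv_le_of_forall_mem_sphere_norm_le hρ ?_
      fun w hw => hB w (hs (Metric.sphere_subset_closedBall hw))
    refine DifferentiableOn.diffContOnCl_ball ?_ subset_rfl
    exact hh.mono (hs.trans (hsub hr))
  have hg' : ∀ z ∈ Metric.closedBall c (R - 2 * ρ), ‖deriv f z / f z‖ ≤ 2 * M * R / ρ / ρ := by
    intro z hz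
    have := hcauchy (h := g) (r := R - 2 * ρ) (B := 2 * M * R / ρ)
      (fun w hw => (hg w hw).differentiableAt.differentiableWithinAt) (by linarith)
      (fun w hw => hgb w (by convert hw using 2; ring)) z hz
    rwa [(hg z (hsub (by linarith) hz)).deriv] at this
  refine ⟨hg', hcauchy hL (by linarith) fun z hz => hg' z (by convert hz using 2; ring)⟩

/-- The fractional part, restricted to `(1, ∞)`. -/
def fractTail (x : ℝ) : ℂ := (Set.Ioi (1 : ℝ)).indicator (fun y => ((Int.fract y : ℝ) : ℂ)) x

theorem measurable_fractTail : Measurable fractTail :=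
  (Complex.measurable_ofReal.comp measurable_fract).indicator measurableSet_Ioi

theorem norm_fractTail_le (x : ℝ) : ‖fractTail x‖ ≤ 1 := by
  unfold fractTail
  by_cases h : x ∈ Set.Ioi (1 : ℝ)
  · rw [Set.indicator_of_mem h, Complex.norm_real, Real.norm_eq_abs,
      abs_of_nonneg (Int.fract_nonneg x)]
    exact (Int.fract_lt_one x).le
  · simp [Set.indicator_of_notMem h]

theorem fractTail_isBigO_atTop : fractTail =O[atTop] fun x : ℝ => x ^ (-(0 : ℝ)) := by
  refine IsBigO.of_bound 1 (Eventually.of_forall fun x => ?_)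
  simpa using norm_fractTail_le x

theorem fractTail_isBigO_zero (b : ℝ) :
    fractTail =O[nhdsWithin 0 (Set.Ioi 0)] fun x : ℝ => x ^ (-b) := by
  have : fractTail =ᶠ[nhdsWithin 0 (Set.Ioi 0)] fun _ => 0 := by
    filter_upwards [nhdsWithin_le_nhds (Iio_mem_nhds one_pos)] with x hx
    exact Set.indicator_of_notMem (by simpa using hx.le) _
  exact this.trans_isBigO (isBigO_zero _ _)

theorem locallyIntegrableOn_fractTail : LocallyIntegrableOn fractTail (Set.Ioi 0) := by
  refine LocallyIntegrable.locallyIntegrableOn ?_ _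
  refine (locallyIntegrable_const (1 : ℝ)).mono measurable_fractTail.aestronglyMeasurable ?_
  exact Eventually.of_forall fun x => by simpa using norm_fractTail_le x

theorem differentiableAt_mellin_fractTail {s : ℂ} (hs : s.re < 0) :
    DifferentiableAt ℂ (mellin fractTail) s :=
  mellin_differentiableAt_of_isBigO_rpow (a := 0) (b := s.re - 1) locallyIntegrableOn_fractTail
    fractTail_isBigO_atTop hs (fractTail_isBigO_zero _) (by linarith)

theorem mellin_fractTail (s : ℂ) :
    mellin fractTail (-s) =
      ∫ x in Set.Ioi (1 : ℝ), (x : ℂ) ^ (-(s + 1)) * ((Int.fract x : ℝ) : ℂ) := by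
  have h : ∀ x : ℝ, (x : ℂ) ^ (-s - 1) • fractTail x =
      (Set.Ioi (1 : ℝ)).indicator
        (fun x => (x : ℂ) ^ (-(s + 1)) * ((Int.fract x : ℝ) : ℂ)) x := by
    intro x
    rw [fractTail, neg_add, sub_eq_add_neg]
    by_cases h : x ∈ Set.Ioi (1 : ℝ)
    · simp only [Set.indicator_of_mem h, smul_eq_mul]
    · simp only [Set.indicator_of_notMem h, smul_zero]
  simp_rw [mellin, h]
  rw [integral_indicator measurableSet_Ioi, Measure.restrict_restrict measurableSet_Ioi]
  congr 2
  exact Set.inter_eq_left.mpr (Set.Ioi_subset_Ioi zero_le_one)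

theorem norm_mellin_fractTail_le {s : ℂ} (hs : 0 < s.re) :
    ‖mellin fractTail (-s)‖ ≤ 1 / s.re := by
  rw [mellin_fractTail]
  have hint := integral_Ioi_rpow_of_lt (a := -(s.re + 1)) (by linarith) one_pos
  refine (norm_integral_le_of_norm_le
    (integrableOn_Ioi_rpow_of_lt (a := -(s.re + 1)) (by linarith) one_pos) ?_).trans (le_of_eq ?_)
  · refine (ae_restrict_iff' measurableSet_Ioi).mpr (Eventually.of_forall fun x hx => ?_)
    have hx0 : 0 < x := one_pos.trans hx
    rw [norm_mul, Complex.norm_cpow_eq_rpow_re_of_pos hx0, Complex.norm_real, Real.norm_eq_abs,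
      abs_of_nonneg (Int.fract_nonneg x)]
    simp only [neg_re, add_re, one_re]
    exact mul_le_of_le_one_right (by positivity) (Int.fract_lt_one x).le
  · rw [hint, Real.one_rpow]
    have : s.re ≠ 0 := hs.ne'
    rw [show -(s.re + 1) + 1 = -s.re by ring, neg_div_neg_eq]

theorem riemannZeta_eq_sub_mellin_fractTail {s : ℂ} (hs : 1 < s.re) :
    riemannZeta s = s / (s - 1) - s * mellin fractTail (-s) := by
  have hs1 : s - 1 ≠ 0 := by
    intro h
    have := congrArg Complex.re h
    simp at this
    linarith
  rw [← LSeries_one_eq_riemannZeta hs, LSeries_eq_mul_integral (1 : ℕ → ℂ) zero_le_one hs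
    (LSeriesHasSum_one hs).LSeriesSummable]
  · rw [mellin_fractTail, div_eq_mul_inv, ← mul_sub]
    congr 1
    have h1 : ∫ x in Set.Ioi (1 : ℝ), (x : ℂ) ^ (-s) = (s - 1)⁻¹ := by
      rw [integral_Ioi_cpow_of_lt (by simpa using hs) one_pos]
      rw [ofReal_one, Complex.one_cpow, show -s + 1 = -(s - 1) by ring, neg_div_neg_eq, one_div]
    rw [← h1, ← integral_sub]
    · refine setIntegral_congr_fun measurableSet_Ioi fun x hx => ?_
      have hx0 : (0 : ℝ) < x := one_pos.trans hx
      have hxc : (x : ℂ) ≠ 0 := by exact_mod_cast hx0.ne'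
      have hfl : ((⌊x⌋₊ : ℝ) : ℂ) = x - ((Int.fract x : ℝ) : ℂ) := by
        rw [← ofReal_sub]
        congr 1
        rw [Int.fract, sub_sub_cancel]
        exact natCast_floor_eq_intCast_floor hx0.le
      have hp : (x : ℂ) ^ (-s) = x * (x : ℂ) ^ (-(s + 1)) := by
        rw [show -s = -(s + 1) + 1 by ring, Complex.cpow_add _ _ hxc, Complex.cpow_one, mul_comm]
      simp only [Pi.one_apply, Finset.sum_const, Nat.card_Icc, add_tsub_cancel_right, nsmul_eq_mul,
        mul_one]
      rw [hp, ← ofReal_natCast, hfl]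
      ring
    · exact integrableOn_Ioi_cpow_of_lt (by simpa using hs) one_pos
    · refine Integrable.mono' (integrableOn_Ioi_rpow_of_lt (a := -(s.re + 1)) (by linarith)
        one_pos) (by fun_prop) ?_
      refine (ae_restrict_iff' measurableSet_Ioi).mpr (Eventually.of_forall fun x hx => ?_)
      have hx0 : 0 < x := one_pos.trans hx
      rw [norm_mul, Complex.norm_cpow_eq_rpow_re_of_pos hx0, Complex.norm_real, Real.norm_eq_abs,
        abs_of_nonneg (Int.fract_nonneg x)]
      simp only [neg_re, add_re, one_re]
      exact mul_le_of_le_one_right (by positivity) (Int.fract_lt_one x).le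
  · refine IsBigO.of_bound 1 (Eventually.of_forall fun n => ?_)
    simp

theorem riemannZeta₁_eq_of_re_pos {s : ℂ} (hs : 0 < s.re) :
    riemannZeta₁ s = s - s * (s - 1) * mellin fractTail (-s) := by
  have hopen : IsOpen {z : ℂ | 0 < z.re} := isOpen_lt continuous_const Complex.continuous_re
  have hconv : Convex ℝ {z : ℂ | 0 < z.re} := convex_halfSpace_re_gt 0
  have h1 : AnalyticOnNhd ℂ riemannZeta₁ {z : ℂ | 0 < z.re} :=
    differentiable_riemannZeta₁.differentiableOn.analyticOnNhd hopen
  have h2 : AnalyticOnNhd ℂ (fun s => s - s * (s - 1) * mellin fractTail (-s))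
      {z : ℂ | 0 < z.re} := by
    refine DifferentiableOn.analyticOnNhd (fun z hz => ?_) hopen
    have h3 : DifferentiableAt ℂ (fun w : ℂ => mellin fractTail (-w)) z :=
      (differentiableAt_mellin_fractTail (s := -z) (by simpa using hz)).comp z (by fun_prop)
    exact DifferentiableAt.differentiableWithinAt (by fun_prop)
  refine h1.eqOn_of_preconnected_of_eventuallyEq h2 hconv.isPreconnected (z₀ := 2) (by simp) ?_ hs
  filter_upwards [(isOpen_lt continuous_const Complex.continuous_re).mem_nhds
    (show (1 : ℝ) < (2 : ℂ).re by simp)] with z hz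
  have hz1 : z ≠ 1 := by
    rintro rfl
    simp at hz
  have hz2 : z - 1 ≠ 0 := sub_ne_zero.mpr hz1
  have := riemannZeta_eq_inv_sub_mul hz1
  rw [riemannZeta_eq_sub_mellin_fractTail hz] at this
  field_simp at this
  linear_combination -this

theorem norm_riemannZeta₁_le {s : ℂ} (hs : 1 / 2 ≤ s.re) :
    ‖riemannZeta₁ s‖ ≤ 3 * (1 + ‖s‖) ^ 2 := by
  rw [riemannZeta₁_eq_of_re_pos (by linarith)]
  have h1 : ‖mellin fractTail (-s)‖ ≤ 2 := by
    refine (norm_mellin_fractTail_le (by linarith)).trans ?_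
    rw [div_le_iff₀ (by linarith)]
    linarith
  have h2 : ‖s - 1‖ ≤ 1 + ‖s‖ := by
    have := norm_sub_le s 1
    rw [norm_one] at this
    linarith
  have h0 := norm_nonneg s
  calc _ ≤ ‖s‖ + ‖s * (s - 1) * mellin fractTail (-s)‖ := norm_sub_le _ _
    _ ≤ ‖s‖ + ‖s‖ * (1 + ‖s‖) * 2 := by
        rw [norm_mul, norm_mul]
        gcongr
    _ ≤ 3 * (1 + ‖s‖) ^ 2 := by nlinarith

theorem norm_riemannZeta_ge {s : ℂ} (hs : s.re = 2) : 1 / 4 ≤ ‖riemannZeta s‖ := by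
  have h1 : 1 < s.re := by linarith
  have hz := zeta_eq_tsum_one_div_nat_add_one_cpow h1
  have hn : ∀ n : ℕ, ‖1 / ((n : ℂ) + 1) ^ s‖ = 1 / ((n : ℝ) + 1) ^ 2 := by
    intro n
    have : ((n : ℂ) + 1) = (((n : ℝ) + 1 : ℝ) : ℂ) := by push_cast; ring
    rw [norm_div, norm_one, this, Complex.norm_cpow_eq_rpow_re_of_pos (by positivity), hs]
    norm_num
  have hs0 : HasSum (fun n : ℕ => 1 / ((n : ℝ) + 1) ^ 2) (π ^ 2 / 6) := by
    have := (hasSum_nat_add_iff' 1).mpr hasSum_zeta_two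
    simpa using this
  have hsum : Summable fun n : ℕ => 1 / ((n : ℂ) + 1) ^ s := by
    refine Summable.of_norm ?_
    simp_rw [hn]
    exact hs0.summable
  rw [hsum.tsum_eq_zero_add] at hz
  have hs1 := (hasSum_nat_add_iff' 1).mpr hs0
  have hb : ‖∑' n : ℕ, 1 / (((n + 1 : ℕ) : ℂ) + 1) ^ s‖ ≤ π ^ 2 / 6 - 1 := by
    refine tsum_of_norm_bounded (g := fun n : ℕ => 1 / (((n + 1 : ℕ) : ℝ) + 1) ^ 2) ?_ fun n => ?_
    · simpa using hs1
    · exact (hn (n + 1)).le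
  have hpi : π ^ 2 / 6 - 1 ≤ 3 / 4 := by nlinarith [Real.pi_lt_d2, Real.pi_gt_three]
  have h3 : (1 : ℂ) = riemannZeta s - ∑' n : ℕ, 1 / (((n + 1 : ℕ) : ℂ) + 1) ^ s := by
    rw [hz]
    simp
  have h4 : (1 : ℝ) ≤ ‖riemannZeta s‖ + ‖∑' n : ℕ, 1 / (((n + 1 : ℕ) : ℂ) + 1) ^ s‖ := by
    rw [← norm_one (α := ℂ)]
    exact (congrArg norm h3).le.trans (norm_sub_le _ _)
  linarith

theorem norm_riemannZeta₁_ge {s : ℂ} (hs : s.re = 2) : 1 / 4 ≤ ‖riemannZeta₁ s‖ := by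
  have h1 : s ≠ 1 := by
    rintro rfl
    norm_num at hs
  have h2 : 1 ≤ ‖s - 1‖ := by
    have := Complex.abs_re_le_norm (s - 1)
    simp only [sub_re, one_re, hs] at this
    norm_num at this
    exact this
  have h3 := norm_riemannZeta_ge hs
  rw [riemannZeta_eq_inv_sub_mul h1, norm_mul, norm_inv] at h3
  have h4 : ‖s - 1‖⁻¹ ≤ 1 := inv_le_one_of_one_le₀ h2
  nlinarith [norm_nonneg (riemannZeta₁ s)]

/-- The logarithmic derivative of `(s - 1) ζ(s)`. -/
def zetaL (s : ℂ) : ℂ := deriv riemannZeta₁ s / riemannZeta₁ s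

/-- `ζ''/ζ` with its polar part at `s = 1` removed. -/
def zetaH (s : ℂ) : ℂ := deriv zetaL s + zetaL s ^ 2 - 2 * dslope zetaL 1 s

theorem isOpen_half_lt_re : IsOpen {s : ℂ | 1 / 2 < s.re} :=
  isOpen_lt continuous_const Complex.continuous_re

theorem zetaL_one : zetaL 1 = Real.eulerMascheroniConstant := by
  simp [zetaL]

theorem riemannZeta₁_ne_zero_of_RH
    (hRH : ∀ s : ℂ, 0 < s.re → s.re < 1 → riemannZeta s = 0 → s.re = 1 / 2) {s : ℂ}
    (hs : 1 / 2 < s.re) : riemannZeta₁ s ≠ 0 := by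
  by_cases h1 : s = 1
  · simp [h1]
  · intro h0
    have hz : riemannZeta s = 0 := by rw [riemannZeta_eq_inv_sub_mul h1, h0, mul_zero]
    rcases lt_or_ge s.re 1 with h | h
    · linarith [hRH s (by linarith) h hz]
    · exact riemannZeta_ne_zero_of_one_le_re h hz

theorem differentiableOn_zetaL
    (hRH : ∀ s : ℂ, 0 < s.re → s.re < 1 → riemannZeta s = 0 → s.re = 1 / 2) :
    DifferentiableOn ℂ zetaL {s : ℂ | 1 / 2 < s.re} :=
  (differentiable_riemannZeta₁.differentiableOn.deriv isOpen_half_lt_re).div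
    differentiable_riemannZeta₁.differentiableOn fun _ hs => riemannZeta₁_ne_zero_of_RH hRH hs

theorem differentiableOn_zetaH
    (hRH : ∀ s : ℂ, 0 < s.re → s.re < 1 → riemannZeta s = 0 → s.re = 1 / 2) :
    DifferentiableOn ℂ zetaH {s : ℂ | 1 / 2 < s.re} := by
  have hL := differentiableOn_zetaL hRH
  have h1 : DifferentiableOn ℂ (dslope zetaL 1) {s : ℂ | 1 / 2 < s.re} :=
    (Complex.differentiableOn_dslope (isOpen_half_lt_re.mem_nhds (by norm_num))).mpr hL
  exact ((hL.deriv isOpen_half_lt_re).add (hL.pow 2)).sub (h1.const_mul 2)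

theorem deriv_deriv_riemannZeta_div
    (hRH : ∀ s : ℂ, 0 < s.re → s.re < 1 → riemannZeta s = 0 → s.re = 1 / 2) {s : ℂ}
    (hs : 1 / 2 < s.re) (hs1 : s ≠ 1) :
    deriv (deriv riemannZeta) s / riemannZeta s =
      zetaH s + (2 / (s - 1) ^ 2 - 2 * Real.eulerMascheroniConstant / (s - 1)) := by
  have hs2 : s - 1 ≠ 0 := sub_ne_zero.mpr hs1
  have hf := riemannZeta₁_ne_zero_of_RH hRH hs
  have hd1 : HasDerivAt riemannZeta₁ (deriv riemannZeta₁ s) s :=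
    (differentiable_riemannZeta₁ s).hasDerivAt
  have hd2 : HasDerivAt (deriv riemannZeta₁) (deriv (deriv riemannZeta₁) s) s :=
    (differentiable_riemannZeta₁.deriv s).hasDerivAt
  have hi : HasDerivAt (fun z : ℂ => (z - 1)⁻¹) (-1 / (s - 1) ^ 2) s :=
    ((hasDerivAt_id s).sub_const 1).inv hs2
  have hdd : deriv (deriv riemannZeta) s =
      deriv (deriv riemannZeta₁) s / (s - 1) - 2 * deriv riemannZeta₁ s / (s - 1) ^ 2 +
        2 * riemannZeta₁ s / (s - 1) ^ 3 := by
    have he : deriv riemannZeta =ᶠ[nhds s] fun z =>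
        - ((z - 1)⁻¹) ^ 2 * (riemannZeta₁ z) + (z - 1)⁻¹ * deriv riemannZeta₁ z := by
      filter_upwards [compl_singleton_mem_nhds hs1] with z hz
      exact deriv_riemannZeta_eq_neg_inv_sub_sq_mul_add hz
    rw [he.deriv_eq]
    have := (((hi.pow 2).neg).mul hd1).add (hi.mul hd2)
    refine (HasDerivAt.deriv this).trans ?_
    simp only [Pi.neg_apply, Pi.pow_apply, Nat.add_one_sub_one, pow_one, Nat.cast_ofNat]
    field_simp
    ring
  have hL' : deriv zetaL s = deriv (deriv riemannZeta₁) s / riemannZeta₁ s - zetaL s ^ 2 := by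
    refine (HasDerivAt.deriv (hd2.div hd1 hf)).trans ?_
    rw [zetaL]
    field_simp
  rw [zetaH, dslope_of_ne _ hs1, slope_def_field, zetaL_one, hL', hdd,
    riemannZeta_eq_inv_sub_mul hs1, zetaL]
  field_simp
  ring

theorem exists_norm_zetaL_le
    (hRH : ∀ s : ℂ, 0 < s.re → s.re < 1 → riemannZeta s = 0 → s.re = 1 / 2) :
    ∃ C : ℝ, 0 < C ∧ ∀ s : ℂ, 3 / 5 ≤ s.re → s.re ≤ 3 / 2 →
      ‖zetaL s‖ ≤ C * (1 + |s.im|) ∧ ‖deriv zetaL s‖ ≤ C * (1 + |s.im|) := by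
  obtain ⟨R, hR⟩ : ∃ R : ℝ, R = 149 / 100 := ⟨_, rfl⟩
  obtain ⟨ρ, hρ⟩ : ∃ ρ : ℝ, ρ = 3 / 100 := ⟨_, rfl⟩
  have hR0 : 0 < R := by norm_num [hR]
  have hρ0 : 0 < ρ := by norm_num [hρ]
  refine ⟨2 * 10 * R / ρ / ρ / ρ, by positivity, fun s hs1 hs2 => ?_⟩
  set c : ℂ := 2 + s.im * Complex.I with hc
  set M : ℝ := 10 + 2 * |s.im| with hM
  have ht : 0 ≤ |s.im| := abs_nonneg _
  have hball : ∀ z ∈ Metric.ball c R, 1 / 2 < z.re := by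
    intro z hz
    rw [mem_ball_iff_norm] at hz
    have := (abs_lt.mp ((Complex.abs_re_le_norm (z - c)).trans_lt hz)).1
    simp [hc] at this
    linarith
  have hcre : c.re = 2 := by simp [hc]
  have hcn : ‖c‖ ≤ 2 + |s.im| := by
    refine (norm_add_le _ _).trans ?_
    simp
  have hgrow : ∀ z ∈ Metric.ball c R, ‖riemannZeta₁ z‖ ≤ Real.exp M * ‖riemannZeta₁ c‖ := by
    intro z hz
    have h1 := norm_riemannZeta₁_le (hball z hz).le
    have h2 := norm_riemannZeta₁_ge hcre
    rw [mem_ball_iff_norm] at hz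
    have h3 : ‖z‖ ≤ 4 + |s.im| := by
      have := norm_sub_norm_le z c
      linarith
    have h4 : 12 * (5 + |s.im|) ^ 2 ≤ Real.exp M := by
      have e1 : (1024 : ℝ) ≤ Real.exp 10 := by
        have : Real.exp 10 = Real.exp 1 ^ 10 := by rw [← Real.exp_nat_mul]; norm_num
        rw [this]
        calc (1024 : ℝ) = 2 ^ 10 := by norm_num
          _ ≤ _ := by
            gcongr
            linarith [Real.exp_one_gt_d9]
      have e2 : 1 + |s.im| ≤ Real.exp |s.im| := by linarith [Real.add_one_le_exp |s.im|]
      have e3 : Real.exp M = Real.exp 10 * Real.exp |s.im| ^ 2 := by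
        rw [hM, Real.exp_add, ← Real.exp_nat_mul]; norm_num
      rw [e3]
      calc 12 * (5 + |s.im|) ^ 2 ≤ 1024 * (1 + |s.im|) ^ 2 := by nlinarith
        _ ≤ _ := by gcongr
    have h5 : 3 * (1 + ‖z‖) ^ 2 ≤ 3 * (5 + |s.im|) ^ 2 := by
      have : 1 + ‖z‖ ≤ 5 + |s.im| := by linarith
      gcongr
    have h6 : Real.exp M * (1 / 4) ≤ Real.exp M * ‖riemannZeta₁ c‖ := by gcongr
    linarith
  have key := norm_logDeriv_le_of_norm_le (f := riemannZeta₁) (c := c) (R := R) (ρ := ρ) (M := M)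
    (by norm_num [hρ]) (by norm_num [hρ, hR]) (by positivity)
    differentiable_riemannZeta₁.differentiableOn
    (fun z hz => riemannZeta₁_ne_zero_of_RH hRH (hball z hz)) hgrow
  have hdist : ‖s - c‖ ≤ 7 / 5 := by
    have : s - c = ((s.re - 2 : ℝ) : ℂ) := by
      apply Complex.ext <;> simp [hc]
    rw [this, Complex.norm_real, Real.norm_eq_abs, abs_le]
    constructor <;> linarith
  have hMle : M ≤ 10 * (1 + |s.im|) := by rw [hM]; linarith
  constructor
  · refine (key.1 s ?_).trans ?_
    · rw [mem_closedBall_iff_norm]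
      refine hdist.trans ?_
      norm_num [hR, hρ]
    · simp only [hR, hρ]
      linarith
  · refine (key.2 s ?_).trans ?_
    · rw [mem_closedBall_iff_norm]
      refine hdist.trans ?_
      norm_num [hR, hρ]
    · simp only [hR, hρ]
      linarith

theorem exists_norm_zetaH_le
    (hRH : ∀ s : ℂ, 0 < s.re → s.re < 1 → riemannZeta s = 0 → s.re = 1 / 2) :
    ∃ C : ℝ, 0 < C ∧ ∀ s : ℂ, 3 / 5 ≤ s.re → s.re ≤ 3 / 2 →
      ‖zetaH s‖ ≤ C * (1 + s.im ^ 2) := by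
  obtain ⟨C, hC, hb⟩ := exists_norm_zetaL_le hRH
  refine ⟨2 * (3 * C + C ^ 2), by positivity, fun s hs1 hs2 => ?_⟩
  obtain ⟨h1, h2⟩ := hb s hs1 hs2
  set t := |s.im| with ht
  have ht0 : 0 ≤ t := abs_nonneg _
  have hslope : ‖dslope zetaL 1 s‖ ≤ C * (1 + t) := by
    by_cases h : s = 1
    · rw [h, dslope_same, ← h]
      exact h2
    · rw [dslope_of_ne _ h, slope_def_field, norm_div,
        div_le_iff₀ (norm_pos_iff.mpr (sub_ne_zero.mpr h))]
      have hconv : Convex ℝ {z : ℂ | (3 / 5 ≤ z.re ∧ z.re ≤ 3 / 2) ∧ -t ≤ z.im ∧ z.im ≤ t} :=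
        ((convex_halfSpace_re_ge _).inter (convex_halfSpace_re_le _)).inter
          ((convex_halfSpace_im_ge _).inter (convex_halfSpace_im_le _))
      refine hconv.norm_image_sub_le_of_norm_deriv_le (f := zetaL) (fun z hz => ?_)
        (fun z hz => ?_) ?_ ?_
      · refine (differentiableOn_zetaL hRH).differentiableAt (isOpen_half_lt_re.mem_nhds ?_)
        have := hz.1.1
        change (1 / 2 : ℝ) < z.re
        linarith
      · refine (hb z hz.1.1 hz.1.2).2.trans ?_
        have := abs_le.mpr hz.2
        gcongr
      · refine ⟨⟨?_, ?_⟩, ?_, ?_⟩ <;> norm_num [ht0]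
      · exact ⟨⟨hs1, hs2⟩, neg_abs_le _, le_abs_self _⟩
  have hsq : s.im ^ 2 = t ^ 2 := (sq_abs _).symm
  rw [hsq]
  have h3 : ‖zetaL s‖ ^ 2 ≤ (C * (1 + t)) ^ 2 := by gcongr
  have h4 : ‖zetaH s‖ ≤ ‖deriv zetaL s‖ + ‖zetaL s‖ ^ 2 + 2 * ‖dslope zetaL 1 s‖ := by
    rw [zetaH]
    refine (norm_sub_le _ _).trans ?_
    rw [norm_mul, Complex.norm_ofNat]
    gcongr
    refine (norm_add_le _ _).trans ?_
    rw [norm_pow]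
  have h5 : 1 + t ≤ 2 * (1 + t ^ 2) := by nlinarith [sq_nonneg (t - 1)]
  have h6 : (1 + t) ^ 2 ≤ 2 * (1 + t ^ 2) := by nlinarith [sq_nonneg (t - 1)]
  calc ‖zetaH s‖ ≤ 3 * C * (1 + t) + C ^ 2 * (1 + t) ^ 2 := by nlinarith
    _ ≤ 3 * C * (2 * (1 + t ^ 2)) + C ^ 2 * (2 * (1 + t ^ 2)) := by gcongr
    _ = _ := by ring

/-- Smooth compactly supported functions on `ℝ` that vanish on `(-∞, 0]`. -/
structure MellinTest (Φ : ℝ → ℝ) : Prop where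
  contDiff : ContDiff ℝ (⊤ : ℕ∞) Φ
  hasCompactSupport : HasCompactSupport Φ
  support_subset : Function.support Φ ⊆ Set.Ioi 0

namespace MellinTest

variable {Φ : ℝ → ℝ}

theorem apply_eq_zero (h : MellinTest Φ) {x : ℝ} (hx : x ≤ 0) : Φ x = 0 := by
  by_contra hne
  exact absurd (h.support_subset hne) (not_lt.mpr hx)

theorem exists_bound (h : MellinTest Φ) :
    ∃ C R : ℝ, 0 < C ∧ 1 ≤ R ∧ (∀ x, |Φ x| ≤ C * |x|) ∧ ∀ x, R < x → Φ x = 0 := by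
  obtain ⟨K, hK⟩ := h.contDiff.lipschitzWith_of_hasCompactSupport h.hasCompactSupport (by simp)
  obtain ⟨R, hR⟩ := h.hasCompactSupport.isCompact.isBounded.subset_closedBall 0
  refine ⟨K + 1, max R 1, by positivity, le_max_right _ _, fun x => ?_, fun x hx => ?_⟩
  · have := hK.norm_sub_le x 0
    rw [h.apply_eq_zero le_rfl, sub_zero, sub_zero, Real.norm_eq_abs, Real.norm_eq_abs] at this
    nlinarith [abs_nonneg x]
  · by_contra hne
    have := hR (subset_tsupport _ hne)
    rw [mem_closedBall_zero_iff, Real.norm_eq_abs] at this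
    linarith [le_abs_self x, le_max_left R 1]

theorem mul_deriv (h : MellinTest Φ) : MellinTest fun x => x * deriv Φ x where
  contDiff := contDiff_id.mul (h.contDiff.iterate_deriv 1)
  hasCompactSupport := h.hasCompactSupport.deriv.mul_left
  support_subset := by
    intro x hx
    by_contra hx0
    rw [Set.mem_Ioi, not_lt] at hx0
    rcases hx0.lt_or_eq with hlt | heq
    · have : Φ =ᶠ[nhds x] fun _ => 0 := by
        filter_upwards [Iio_mem_nhds hlt] with y hy
        exact h.apply_eq_zero (le_of_lt hy)
      exact hx (by simp [this.deriv_eq])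
    · exact hx (by simp [heq])

theorem isBigO_atTop (h : MellinTest Φ) (a : ℝ) :
    (fun x => (Φ x : ℂ)) =O[atTop] fun x : ℝ => x ^ a := by
  obtain ⟨C, R, -, -, -, h0⟩ := h.exists_bound
  have : (fun x => (Φ x : ℂ)) =ᶠ[atTop] fun _ => 0 := by
    filter_upwards [eventually_gt_atTop R] with x hx
    simp [h0 x hx]
  exact this.trans_isBigO (isBigO_zero _ _)

theorem isBigO_zero (h : MellinTest Φ) :
    (fun x => (Φ x : ℂ)) =O[nhdsWithin 0 (Set.Ioi 0)] fun x : ℝ => x ^ (-(-1 : ℝ)) := by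
  obtain ⟨C, R, -, -, hb, -⟩ := h.exists_bound
  refine IsBigO.of_bound C (Eventually.of_forall fun x => ?_)
  simpa using hb x

theorem continuous_ofReal (h : MellinTest Φ) : Continuous fun x => (Φ x : ℂ) :=
  Complex.continuous_ofReal.comp h.contDiff.continuous

theorem mellinC_eq (Φ : ℝ → ℝ) (s : ℂ) : mellinC Φ s = mellin (fun x => (Φ x : ℂ)) s := by
  simp only [mellinC, mellin, smul_eq_mul, mul_comm]

theorem mellinConvergent (h : MellinTest Φ) {s : ℂ} (hs : -1 < s.re) :
    MellinConvergent (fun x => (Φ x : ℂ)) s :=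
  mellinConvergent_of_isBigO_rpow (a := s.re + 1) (b := -1)
    (h.continuous_ofReal.locallyIntegrable.locallyIntegrableOn _)
    (h.isBigO_atTop _) (by linarith) h.isBigO_zero hs

theorem differentiableAt_mellinC (h : MellinTest Φ) {s : ℂ} (hs : -1 < s.re) :
    DifferentiableAt ℂ (mellinC Φ) s := by
  rw [funext (mellinC_eq Φ)]
  exact mellin_differentiableAt_of_isBigO_rpow (a := s.re + 1) (b := -1)
    (h.continuous_ofReal.locallyIntegrable.locallyIntegrableOn _)
    (h.isBigO_atTop _) (by linarith) h.isBigO_zero hs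

theorem exists_norm_mellinC_le (h : MellinTest Φ) :
    ∃ B : ℝ, 0 < B ∧ ∀ s : ℂ, -(1 / 2) ≤ s.re → s.re ≤ 1 → ‖mellinC Φ s‖ ≤ B := by
  obtain ⟨C, R, hC, hR, hb, h0⟩ := h.exists_bound
  set g : ℝ → ℝ := (Set.Ioc 0 R).indicator fun x => C * R ^ (3 / 2 : ℝ) * x ^ (-(1 / 2) : ℝ) with hg
  have hgi : IntegrableOn g (Set.Ioi 0) := by
    refine Integrable.integrableOn ?_
    rw [hg, integrable_indicator_iff measurableSet_Ioc,
      ← intervalIntegrable_iff_integrableOn_Ioc_of_le (by linarith)]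
    exact (intervalIntegral.intervalIntegrable_rpow' (by norm_num)).const_mul _
  refine ⟨|∫ x in Set.Ioi 0, g x| + 1, by positivity, fun s hs1 hs2 => ?_⟩
  refine (norm_integral_le_of_norm_le hgi ?_).trans ((le_abs_self _).trans (by linarith))
  refine (ae_restrict_iff' measurableSet_Ioi).mpr (Eventually.of_forall fun x hx => ?_)
  have hx0 : 0 < x := hx
  rw [norm_mul, Complex.norm_cpow_eq_rpow_re_of_pos hx0, Complex.norm_real, Real.norm_eq_abs]
  rcases le_or_gt x R with hxR | hxR
  · rw [hg, Set.indicator_of_mem (show x ∈ Set.Ioc 0 R from ⟨hx0, hxR⟩)]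
    have hbx := hb x
    rw [abs_of_pos hx0] at hbx
    have e1 : x * x ^ (s - 1).re = x ^ (s.re + 1 / 2) * x ^ (-(1 / 2) : ℝ) := by
      have := Real.rpow_add hx0 1 (s - 1).re
      rw [Real.rpow_one] at this
      rw [← Real.rpow_add hx0, ← this]
      congr 1
      simp
    have e2 : x ^ (s.re + 1 / 2) ≤ R ^ (3 / 2 : ℝ) :=
      (Real.rpow_le_rpow hx0.le hxR (by linarith)).trans
        (Real.rpow_le_rpow_of_exponent_le hR (by linarith))
    calc |Φ x| * x ^ (s - 1).re ≤ C * x * x ^ (s - 1).re := by gcongr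
      _ = C * (x ^ (s.re + 1 / 2) * x ^ (-(1 / 2) : ℝ)) := by rw [mul_assoc, e1]
      _ ≤ C * (R ^ (3 / 2 : ℝ) * x ^ (-(1 / 2) : ℝ)) := by gcongr
      _ = _ := by ring
  · rw [h0 x hxR, hg, Set.indicator_of_notMem (fun hmem => absurd hmem.2 (not_le.mpr hxR))]
    simp

theorem mellinC_mul_deriv (h : MellinTest Φ) {s : ℂ} (hs : -1 < s.re) :
    mellinC (fun x => x * deriv Φ x) s = -s * mellinC Φ s := by
  have hF : ∀ x ∈ Set.Ioi (0 : ℝ), HasDerivAt (fun y : ℝ => (Φ y : ℂ) * (y : ℂ) ^ s)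
      ((x : ℂ) ^ (s - 1) • ((x * deriv Φ x : ℝ) : ℂ) +
        s * ((x : ℂ) ^ (s - 1) • (Φ x : ℂ))) x := by
    intro x hx
    have hx0 : (x : ℂ) ≠ 0 := by exact_mod_cast (ne_of_gt hx)
    have h1 : HasDerivAt (fun y : ℝ => (Φ y : ℂ)) ((deriv Φ x : ℝ) : ℂ) x :=
      (((h.contDiff.differentiable (by simp)) x).hasDerivAt).ofReal_comp
    have h2 : HasDerivAt (fun y : ℝ => (y : ℂ) ^ s) (s * (x : ℂ) ^ (s - 1)) x := by
      have := (hasDerivAt_id (x : ℂ)).cpow_const (c := s) (Or.inl (by simpa using hx))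
      simpa using this.comp_ofReal
    convert! h1.mul h2 using 1
    have : (x : ℂ) ^ s = x * (x : ℂ) ^ (s - 1) := by
      have := Complex.cpow_add 1 (s - 1) hx0
      rwa [Complex.cpow_one, add_sub_cancel] at this
    rw [this]
    push_cast
    simp only [smul_eq_mul]
    ring
  have hi1 := h.mul_deriv.mellinConvergent hs
  have hi2 := h.mellinConvergent hs
  obtain ⟨C, R, hC, hR, hb, h0⟩ := h.exists_bound
  have htop : Tendsto (fun y : ℝ => (Φ y : ℂ) * (y : ℂ) ^ s) atTop (nhds 0) := by
    refine tendsto_const_nhds.congr' ?_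
    filter_upwards [eventually_gt_atTop R] with x hx
    simp [h0 x hx]
  have hzero : Tendsto (fun y : ℝ => (Φ y : ℂ) * (y : ℂ) ^ s) (nhdsWithin 0 (Set.Ioi 0))
      (nhds 0) := by
    have hlim : Tendsto (fun y : ℝ => C * y ^ (1 + s.re)) (nhdsWithin 0 (Set.Ioi 0)) (nhds 0) := by
      have : ContinuousAt (fun y : ℝ => C * y ^ (1 + s.re)) 0 :=
        continuousAt_const.mul (Real.continuousAt_rpow_const _ _ (Or.inr (by linarith)))
      have := this.tendsto.mono_left (nhdsWithin_le_nhds (s := Set.Ioi 0))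
      rwa [Real.zero_rpow (by linarith), mul_zero] at this
    refine squeeze_zero_norm' ?_ hlim
    filter_upwards [self_mem_nhdsWithin] with x hx
    have hx0 : 0 < x := hx
    rw [norm_mul, Complex.norm_cpow_eq_rpow_re_of_pos hx0, Complex.norm_real, Real.norm_eq_abs,
      Real.rpow_add hx0, Real.rpow_one, ← mul_assoc]
    have hbx := hb x
    rw [abs_of_pos hx0] at hbx
    gcongr
  rw [mellinC_eq, mellinC_eq]
  have key : ∫ x in Set.Ioi (0 : ℝ), ((x : ℂ) ^ (s - 1) • ((x * deriv Φ x : ℝ) : ℂ) +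
        s * ((x : ℂ) ^ (s - 1) • (Φ x : ℂ))) = 0 - 0 :=
    by
    have hcont : ContinuousWithinAt (fun y : ℝ => (Φ y : ℂ) * (y : ℂ) ^ s) (Set.Ici 0) 0 := by
      refine continuousWithinAt_Ioi_iff_Ici.mp ?_
      simpa [ContinuousWithinAt, h.apply_eq_zero le_rfl] using hzero
    have := integral_Ioi_of_hasDerivAt_of_tendsto hcont hF (hi1.add (hi2.const_mul s)) htop
    simpa [h.apply_eq_zero le_rfl] using this
  rw [integral_add hi1 (hi2.const_mul s), integral_const_mul] at key
  simp only [mellin]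
  linear_combination key

theorem exists_norm_mellinC_mul_le (h : MellinTest Φ) :
    ∃ B : ℝ, 0 < B ∧ ∀ s : ℂ, -(1 / 2) ≤ s.re → s.re ≤ 1 →
      ‖mellinC Φ s‖ * (1 + s.im ^ 2) ^ 2 ≤ B := by
  obtain ⟨B0, hB0, h0⟩ := h.exists_norm_mellinC_le
  have h1 := h.mul_deriv
  have h2 := h1.mul_deriv
  have h3 := h2.mul_deriv
  obtain ⟨B4, hB4, h4⟩ := h3.mul_deriv.exists_norm_mellinC_le
  refine ⟨2 * B0 + 2 * B4, by positivity, fun s hs1 hs2 => ?_⟩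
  have hs : -1 < s.re := by linarith
  have k0 := h0 s hs1 hs2
  have k4 := h4 s hs1 hs2
  rw [h3.mellinC_mul_deriv hs, h2.mellinC_mul_deriv hs, h1.mellinC_mul_deriv hs,
    h.mellinC_mul_deriv hs] at k4
  simp only [norm_mul, norm_neg] at k4
  have him : s.im ^ 2 ≤ ‖s‖ ^ 2 := by
    rw [← sq_abs s.im]
    have := Complex.abs_im_le_norm s
    gcongr
  have him4 : (s.im ^ 2) ^ 2 ≤ (‖s‖ ^ 2) ^ 2 := by gcongr
  have e1 : (1 + s.im ^ 2) ^ 2 ≤ 2 + 2 * (‖s‖ ^ 2) ^ 2 := by nlinarith [sq_nonneg (s.im ^ 2 - 1)]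
  calc ‖mellinC Φ s‖ * (1 + s.im ^ 2) ^ 2 ≤ ‖mellinC Φ s‖ * (2 + 2 * (‖s‖ ^ 2) ^ 2) := by gcongr
    _ ≤ _ := by nlinarith

theorem exists_norm_mellinC_le_inv (h : MellinTest Φ) :
    ∃ B : ℝ, 0 < B ∧ ∀ s : ℂ, -(1 / 2) ≤ s.re → s.re ≤ 1 →
      ‖mellinC Φ s‖ ≤ B * ((1 + s.im ^ 2)⁻¹ * (1 + s.im ^ 2)⁻¹) := by
  obtain ⟨B, hB, hb⟩ := h.exists_norm_mellinC_mul_le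
  refine ⟨B, hB, fun s h1 h2 => ?_⟩
  rw [← mul_inv, ← sq, ← div_eq_mul_inv, le_div_iff₀ (by positivity)]
  exact hb s h1 h2

theorem continuous_mellinC_vertical (h : MellinTest Φ) {σ : ℂ} (hσ : -1 < σ.re) :
    Continuous fun t : ℝ => mellinC Φ (σ + t * Complex.I) := by
  refine continuous_iff_continuousAt.mpr fun t => ?_
  have h1 : ContinuousAt (mellinC Φ) (σ + t * Complex.I) :=
    (h.differentiableAt_mellinC (by simpa using hσ)).continuousAt
  exact ContinuousAt.comp (f := fun t : ℝ => σ + t * Complex.I) h1 (by fun_prop)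

theorem integrable_mellinC_vertical (h : MellinTest Φ) {σ : ℂ} (h1 : -(1 / 2) ≤ σ.re)
    (h2 : σ.re ≤ 1) (h3 : σ.im = 0) :
    Integrable fun t : ℝ => mellinC Φ (σ + t * Complex.I) := by
  obtain ⟨B, hB, hb⟩ := h.exists_norm_mellinC_le_inv
  refine (integrable_inv_one_add_sq.const_mul B).mono'
    (h.continuous_mellinC_vertical (by linarith)).aestronglyMeasurable
    (Eventually.of_forall fun t => ?_)
  have := hb (σ + t * Complex.I) (by simpa using h1) (by simpa using h2)
  simp only [Complex.add_im, Complex.mul_im, Complex.ofReal_re, Complex.I_im, mul_one,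
    Complex.ofReal_im, Complex.I_re, mul_zero, add_zero, h3, zero_add] at this
  refine this.trans ?_
  have : (1 + t ^ 2)⁻¹ ≤ 1 := inv_le_one_of_one_le₀ (by nlinarith [sq_nonneg t])
  have h0 : 0 ≤ (1 + t ^ 2)⁻¹ := by positivity
  gcongr
  nlinarith

/-- Mellin inversion on the line `Re s = 1 / 2 + a`. -/
theorem integral_mellinC_mul_cpow (h : MellinTest Φ) {a x : ℝ} (h1 : -1 ≤ a) (h2 : a ≤ 1 / 2)
    (hx : 0 < x) :
    ∫ t : ℝ, mellinC Φ (1 / 2 + (a + t * Complex.I)) * (x : ℂ) ^ (-((a : ℂ) + t * Complex.I)) =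
      2 * π * (x : ℂ) ^ (1 / 2 : ℂ) * Φ x := by
  have hx0 : (x : ℂ) ≠ 0 := by exact_mod_cast hx.ne'
  have hint : VerticalIntegrable (mellin fun x => (Φ x : ℂ)) (1 / 2 + a) := by
    rw [VerticalIntegrable, ← funext (mellinC_eq Φ)]
    refine h.integrable_mellinC_vertical ?_ ?_ ?_
    · rw [Complex.ofReal_re]; linarith
    · rw [Complex.ofReal_re]; linarith
    · rw [Complex.ofReal_im]
  have key := mellinInv_mellin_eq (1 / 2 + a) (fun x => (Φ x : ℂ)) hx
    (h.mellinConvergent (by rw [Complex.ofReal_re]; linarith)) hint h.continuous_ofReal.continuousAt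
  rw [mellinInv] at key
  have e : ∀ t : ℝ, mellinC Φ (1 / 2 + (a + t * Complex.I)) *
      (x : ℂ) ^ (-((a : ℂ) + t * Complex.I)) = (x : ℂ) ^ (1 / 2 : ℂ) *
        ((x : ℂ) ^ (-(((1 / 2 + a : ℝ) : ℂ) + t * Complex.I)) •
          mellin (fun x => (Φ x : ℂ)) (((1 / 2 + a : ℝ) : ℂ) + t * Complex.I)) := by
    intro t
    rw [smul_eq_mul, ← mul_assoc, ← Complex.cpow_add _ _ hx0, mellinC_eq, mul_comm]
    congr 2 <;> (push_cast; ring)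
  simp_rw [e]
  rw [integral_const_mul]
  have hJ : ∀ J y : ℂ, (1 / (2 * π)) • J = y → J = 2 * π * y := by
    intro J y hJy
    rw [← hJy, Complex.real_smul]
    push_cast
    field_simp
  rw [hJ _ _ key]
  ring

end MellinTest

theorem integrableOn_log_mul_rpow (c : ℝ) {X σ : ℝ} (hX : 0 < X) (hσ : 0 < σ) :
    IntegrableOn (fun x => (2 * Real.log (X * x) - c) * x ^ (-σ - 1)) (Set.Ioi (1 / X)) := by
  have h1 : IntegrableOn (fun x : ℝ => x ^ (-σ - 1)) (Set.Ioi (1 / X)) :=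
    integrableOn_Ioi_rpow_of_lt (by linarith) (by positivity)
  have h2 : IntegrableOn (fun x : ℝ => x ^ (-(σ / 2) - 1)) (Set.Ioi (1 / X)) :=
    integrableOn_Ioi_rpow_of_lt (by linarith) (by positivity)
  refine ((h2.const_mul (4 / σ * X ^ (σ / 2))).add (h1.const_mul |c|)).mono'
    (by fun_prop) ?_
  refine (ae_restrict_iff' measurableSet_Ioi).mpr (Eventually.of_forall fun x hx => ?_)
  have hx1 : 1 / X < x := hx
  have hx0 : 0 < x := lt_trans (by positivity) hx1
  have hXx : 1 ≤ X * x := by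
    rw [div_lt_iff₀ hX] at hx1
    nlinarith
  have hl0 : 0 ≤ Real.log (X * x) := Real.log_nonneg hXx
  have hl := Real.log_le_rpow_div (x := X * x) (by positivity) (half_pos hσ)
  have hp : 0 ≤ x ^ (-σ - 1) := by positivity
  rw [norm_mul, Real.norm_eq_abs, Real.norm_eq_abs, abs_of_nonneg hp]
  have habs : |2 * Real.log (X * x) - c| ≤ 2 * ((X * x) ^ (σ / 2) / (σ / 2)) + |c| := by
    refine (abs_sub _ _).trans ?_
    rw [abs_of_nonneg (by positivity : 0 ≤ 2 * Real.log (X * x))]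
    linarith
  refine (mul_le_mul_of_nonneg_right habs hp).trans (le_of_eq ?_)
  have : x ^ (-(σ / 2) - 1) = x ^ (σ / 2) * x ^ (-σ - 1) := by
    rw [← Real.rpow_add hx0]
    congr 1
    ring
  simp only [Pi.add_apply]
  rw [Real.mul_rpow hX.le hx0.le, this]
  field_simp
  ring

theorem integral_log_mul_cpow (c : ℝ) {X : ℝ} (hX : 0 < X) {w : ℂ} (hw : 0 < w.re) :
    ∫ x in Set.Ioi (1 / X), ((2 * Real.log (X * x) - c : ℝ) : ℂ) * (x : ℂ) ^ (-w - 1) =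
      (2 / w ^ 2 - c / w) * (X : ℂ) ^ w := by
  have hw0 : w ≠ 0 := by
    rintro rfl
    simp at hw
  have hpos : ∀ x ∈ Set.Ici (1 / X), 0 < x := fun x hx => lt_of_lt_of_le (by positivity) hx
  have hder : ∀ x ∈ Set.Ici (1 / X), HasDerivAt
      (fun y : ℝ => -(((2 * Real.log (X * y) - c : ℝ) : ℂ) / w + 2 / w ^ 2) * (y : ℂ) ^ (-w))
      (((2 * Real.log (X * x) - c : ℝ) : ℂ) * (x : ℂ) ^ (-w - 1)) x := by
    intro x hx
    have hx0 := hpos x hx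
    have hxc : (x : ℂ) ≠ 0 := by exact_mod_cast hx0.ne'
    have h1 : HasDerivAt (fun y : ℝ => 2 * Real.log (X * y) - c) (2 * (X / (X * x))) x := by
      have := ((hasDerivAt_id x).const_mul X).log (by simp; exact ⟨hX.ne', hx0.ne'⟩)
      simpa using (this.const_mul 2).sub_const c
    have h2 : HasDerivAt (fun y : ℝ => (y : ℂ) ^ (-w)) (-w * (x : ℂ) ^ (-w - 1)) x := by
      have := (hasDerivAt_id (x : ℂ)).cpow_const (c := -w) (Or.inl (by simpa using hx0))
      simpa using this.comp_ofReal
    convert! ((h1.ofReal_comp.div_const w).add_const (2 / w ^ 2)).neg.mul h2 using 1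
    have : (x : ℂ) ^ (-w) = x * (x : ℂ) ^ (-w - 1) := by
      have := Complex.cpow_add 1 (-w - 1) hxc
      rwa [Complex.cpow_one, add_sub_cancel] at this
    have hXc : (X : ℂ) ≠ 0 := by exact_mod_cast hX.ne'
    simp only [this, Pi.neg_apply]
    push_cast
    field_simp
    ring
  have hint : IntegrableOn (fun x : ℝ => ((2 * Real.log (X * x) - c : ℝ) : ℂ) *
      (x : ℂ) ^ (-w - 1)) (Set.Ioi (1 / X)) := by
    refine Integrable.congr' (integrableOn_log_mul_rpow c hX hw) (by fun_prop) ?_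
    refine (ae_restrict_iff' measurableSet_Ioi).mpr (Eventually.of_forall fun x hx => ?_)
    have hx0 := hpos x (Set.Ioi_subset_Ici_self hx)
    rw [norm_mul, norm_mul, Complex.norm_cpow_eq_rpow_re_of_pos hx0, Complex.norm_real,
      Real.norm_of_nonneg (by positivity : 0 ≤ x ^ (-w.re - 1))]
    simp
  have hpow : Tendsto (fun y : ℝ => (y : ℂ) ^ (-w)) atTop (nhds 0) := by
    rw [tendsto_zero_iff_norm_tendsto_zero]
    refine (tendsto_rpow_neg_atTop hw).congr' ?_
    filter_upwards [eventually_gt_atTop 0] with y hy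
    rw [Complex.norm_cpow_eq_rpow_re_of_pos hy, Complex.neg_re]
  have hlog : Tendsto (fun y : ℝ => (Real.log y : ℂ) * (y : ℂ) ^ (-w)) atTop (nhds 0) := by
    rw [tendsto_zero_iff_norm_tendsto_zero]
    refine (isLittleO_log_rpow_atTop hw).tendsto_div_nhds_zero.norm.congr' ?_ |>.trans (by simp)
    filter_upwards [eventually_gt_atTop 0] with y hy
    rw [norm_mul, Complex.norm_cpow_eq_rpow_re_of_pos hy, Complex.neg_re, Complex.norm_real,
      Real.rpow_neg hy.le, norm_div, div_eq_mul_inv,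
      Real.norm_of_nonneg (by positivity : 0 ≤ y ^ w.re)]
  have htop : Tendsto (fun y : ℝ => -(((2 * Real.log (X * y) - c : ℝ) : ℂ) / w + 2 / w ^ 2) *
      (y : ℂ) ^ (-w)) atTop (nhds 0) := by
    have := (hlog.const_mul (-(2 / w))).add
      (hpow.const_mul (-(((2 * Real.log X - c : ℝ) : ℂ) / w + 2 / w ^ 2)))
    simp only [mul_zero, add_zero] at this
    refine this.congr' ?_
    filter_upwards [eventually_gt_atTop 0] with y hy
    rw [Real.log_mul hX.ne' hy.ne']
    push_cast
    ring
  rw [integral_Ioi_of_hasDerivAt_of_tendsto' hder hint htop]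
  have : ((1 / X : ℝ) : ℂ) ^ (-w) = (X : ℂ) ^ w := by
    rw [one_div, Complex.ofReal_inv, Complex.inv_cpow _ _ (by
      rw [Complex.arg_ofReal_of_nonneg hX.le]; exact Real.pi_pos.ne), Complex.cpow_neg, inv_inv]
  rw [this, mul_one_div_cancel hX.ne', Real.log_one]
  push_cast
  ring

namespace MellinTest

variable {Φ : ℝ → ℝ}

theorem integrable_mellinC_half_add (h : MellinTest Φ) {a : ℝ} (h1 : -1 ≤ a) (h2 : a ≤ 1 / 2) :
    Integrable fun t : ℝ => mellinC Φ (1 / 2 + (a + t * Complex.I)) := by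
  have e : ((1 / 2 + a : ℝ) : ℂ) = 1 / 2 + a := by push_cast; ring
  have := h.integrable_mellinC_vertical (σ := ((1 / 2 + a : ℝ) : ℂ))
    (by rw [Complex.ofReal_re]; linarith) (by rw [Complex.ofReal_re]; linarith)
    (Complex.ofReal_im _)
  simpa only [e, add_assoc] using this

theorem integrable_kernel (h : MellinTest Φ) (c : ℝ) {a b X : ℝ} (ha : 0 < a) (ha2 : a ≤ 1 / 2)
    (hb : 0 < b) (hb2 : b ≤ 1 / 2) (hX : 0 < X) :
    Integrable (fun z : (ℝ × ℝ) × ℝ =>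
      (mellinC Φ (1 / 2 + (b + z.1.1 * Complex.I)) * mellinC Φ (1 / 2 + (a + z.1.2 * Complex.I))) *
        (((2 * Real.log (X * z.2) - c : ℝ) : ℂ) * (z.2 : ℂ) ^
          (-((a + z.1.2 * Complex.I) + (b + z.1.1 * Complex.I)) - 1)))
      ((volume : Measure (ℝ × ℝ)).prod (volume.restrict (Set.Ioi (1 / X)))) := by
  have hk := integrableOn_log_mul_rpow c hX (add_pos ha hb)
  have hV := (h.integrable_mellinC_half_add (by linarith) hb2).mul_prod
    (h.integrable_mellinC_half_add (by linarith) ha2)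
  refine Integrable.congr' (hV.mul_prod (Integrable.ofReal (𝕜 := ℂ) hk)) ?_ ?_
  · refine hV.aestronglyMeasurable.comp_fst.mul (Measurable.aestronglyMeasurable ?_)
    fun_prop
  · have hz := Measure.quasiMeasurePreserving_snd (μ := (volume : Measure (ℝ × ℝ)))
      (ν := volume.restrict (Set.Ioi (1 / X))) |>.ae (ae_restrict_mem measurableSet_Ioi)
    filter_upwards [hz] with z hz
    have hz0 : 0 < z.2 := lt_trans (by positivity) hz
    simp only [norm_mul]
    rw [Complex.norm_cpow_eq_rpow_re_of_pos hz0, RCLike.norm_ofReal, abs_mul,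
      abs_of_nonneg (by positivity : 0 ≤ z.2 ^ (-(a + b) - 1)), Complex.norm_real,
      Real.norm_eq_abs]
    simp

theorem integral_kernel_Ioi (Φ : ℝ → ℝ) (c : ℝ) {a b X : ℝ} (ha : 0 < a)
    (hb : 0 < b) (hX : 0 < X) (p : ℝ × ℝ) :
    ∫ x in Set.Ioi (1 / X),
      (mellinC Φ (1 / 2 + (b + p.1 * Complex.I)) * mellinC Φ (1 / 2 + (a + p.2 * Complex.I))) *
        (((2 * Real.log (X * x) - c : ℝ) : ℂ) * (x : ℂ) ^
          (-((a + p.2 * Complex.I) + (b + p.1 * Complex.I)) - 1)) =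
      (2 / ((a + p.2 * Complex.I) + (b + p.1 * Complex.I)) ^ 2 -
        c / ((a + p.2 * Complex.I) + (b + p.1 * Complex.I))) *
        mellinC Φ (1 / 2 + (a + p.2 * Complex.I)) * mellinC Φ (1 / 2 + (b + p.1 * Complex.I)) *
        (X : ℂ) ^ ((a + p.2 * Complex.I) + (b + p.1 * Complex.I)) := by
  rw [integral_const_mul, integral_log_mul_cpow c hX (by simp; linarith)]
  ring

theorem integral_kernel_prod (h : MellinTest Φ) (c : ℝ) {a b X x : ℝ} (ha : 0 < a)
    (ha2 : a ≤ 1 / 2) (hb : 0 < b) (hb2 : b ≤ 1 / 2) (hx : 0 < x) :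
    ∫ p : ℝ × ℝ,
      (mellinC Φ (1 / 2 + (b + p.1 * Complex.I)) * mellinC Φ (1 / 2 + (a + p.2 * Complex.I))) *
        (((2 * Real.log (X * x) - c : ℝ) : ℂ) * (x : ℂ) ^
          (-((a + p.2 * Complex.I) + (b + p.1 * Complex.I)) - 1)) =
      (((2 * Real.log (X * x) - c) * (4 * π ^ 2 * Φ x ^ 2) : ℝ) : ℂ) := by
  have hx0 : (x : ℂ) ≠ 0 := by exact_mod_cast hx.ne'
  have e : ∀ p : ℝ × ℝ,
      (mellinC Φ (1 / 2 + (b + p.1 * Complex.I)) * mellinC Φ (1 / 2 + (a + p.2 * Complex.I))) *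
        (((2 * Real.log (X * x) - c : ℝ) : ℂ) * (x : ℂ) ^
          (-((a + p.2 * Complex.I) + (b + p.1 * Complex.I)) - 1)) =
      (((2 * Real.log (X * x) - c : ℝ) : ℂ) * (x : ℂ)⁻¹) *
        ((mellinC Φ (1 / 2 + (b + p.1 * Complex.I)) * (x : ℂ) ^ (-((b : ℂ) + p.1 * Complex.I))) *
        (mellinC Φ (1 / 2 + (a + p.2 * Complex.I)) * (x : ℂ) ^ (-((a : ℂ) + p.2 * Complex.I)))) := by
    intro p
    rw [sub_eq_add_neg _ (1 : ℂ), Complex.cpow_add _ _ hx0, Complex.cpow_neg_one, neg_add,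
      Complex.cpow_add _ _ hx0]
    ring
  simp_rw [e]
  rw [integral_const_mul, Measure.volume_eq_prod,
    integral_prod_mul (fun u : ℝ => mellinC Φ (1 / 2 + (b + u * Complex.I)) *
      (x : ℂ) ^ (-((b : ℂ) + u * Complex.I))) (fun t : ℝ => mellinC Φ (1 / 2 + (a + t * Complex.I)) *
      (x : ℂ) ^ (-((a : ℂ) + t * Complex.I))),
    h.integral_mellinC_mul_cpow (by linarith) hb2 hx,
    h.integral_mellinC_mul_cpow (by linarith) ha2 hx]
  have hsq : (x : ℂ) ^ (1 / 2 : ℂ) * (x : ℂ) ^ (1 / 2 : ℂ) = x := by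
    rw [← Complex.cpow_add _ _ hx0]
    norm_num
  calc _ = (((2 * Real.log (X * x) - c : ℝ) : ℂ) * (x : ℂ)⁻¹) * (4 * π ^ 2 * (Φ x : ℂ) ^ 2 *
        ((x : ℂ) ^ (1 / 2 : ℂ) * (x : ℂ) ^ (1 / 2 : ℂ))) := by ring
    _ = _ := by
      rw [hsq]
      push_cast
      field_simp

/-- The polar part of the integrand is integrable over the plane. -/
theorem integrable_polar (h : MellinTest Φ) (c : ℝ) {a b X : ℝ} (ha : 0 < a) (ha2 : a ≤ 1 / 2)
    (hb : 0 < b) (hb2 : b ≤ 1 / 2) (hX : 0 < X) :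
    Integrable fun p : ℝ × ℝ =>
      (2 / ((a + p.2 * Complex.I) + (b + p.1 * Complex.I)) ^ 2 -
        c / ((a + p.2 * Complex.I) + (b + p.1 * Complex.I))) *
        mellinC Φ (1 / 2 + (a + p.2 * Complex.I)) * mellinC Φ (1 / 2 + (b + p.1 * Complex.I)) *
        (X : ℂ) ^ ((a + p.2 * Complex.I) + (b + p.1 * Complex.I)) := by
  have := (h.integrable_kernel c ha ha2 hb hb2 hX).integral_prod_left
  simpa only [integral_kernel_Ioi Φ c ha hb hX] using this

theorem integral_polar (h : MellinTest Φ) (c : ℝ) {a b X : ℝ} (ha : 0 < a) (ha2 : a ≤ 1 / 2)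
    (hb : 0 < b) (hb2 : b ≤ 1 / 2) (hX : 0 < X) :
    ∫ p : ℝ × ℝ,
      (2 / ((a + p.2 * Complex.I) + (b + p.1 * Complex.I)) ^ 2 -
        c / ((a + p.2 * Complex.I) + (b + p.1 * Complex.I))) *
        mellinC Φ (1 / 2 + (a + p.2 * Complex.I)) * mellinC Φ (1 / 2 + (b + p.1 * Complex.I)) *
        (X : ℂ) ^ ((a + p.2 * Complex.I) + (b + p.1 * Complex.I)) =
      ((∫ x in Set.Ioi (1 / X), (2 * Real.log (X * x) - c) * (4 * π ^ 2 * Φ x ^ 2) : ℝ) : ℂ) := by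
  have := integral_integral_swap (f := fun (p : ℝ × ℝ) (x : ℝ) =>
    (mellinC Φ (1 / 2 + (b + p.1 * Complex.I)) * mellinC Φ (1 / 2 + (a + p.2 * Complex.I))) *
        (((2 * Real.log (X * x) - c : ℝ) : ℂ) * (x : ℂ) ^
          (-((a + p.2 * Complex.I) + (b + p.1 * Complex.I)) - 1)))
    (h.integrable_kernel c ha ha2 hb hb2 hX)
  simp only [integral_kernel_Ioi Φ c ha hb hX] at this
  rw [this, ← integral_complex_ofReal]
  refine setIntegral_congr_fun measurableSet_Ioi fun x hx => ?_
  exact h.integral_kernel_prod c ha ha2 hb hb2 (lt_trans (by positivity) hx)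

theorem hasCompactSupport_sq (h : MellinTest Φ) : HasCompactSupport fun x => Φ x ^ 2 :=
  h.hasCompactSupport.comp_left (g := fun y : ℝ => y ^ 2) (by simp)

theorem integrable_sq (h : MellinTest Φ) : Integrable fun x => Φ x ^ 2 :=
  (h.contDiff.continuous.pow 2).integrable_of_hasCompactSupport h.hasCompactSupport_sq

theorem integrable_log_mul_sq (h : MellinTest Φ) : Integrable fun x => Real.log x * Φ x ^ 2 := by
  have hl : LocallyIntegrable Real.log := by
    refine (locallyIntegrable_iff).mpr fun K hK => ?_
    obtain ⟨R, hR⟩ := hK.isBounded.subset_closedBall 0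
    refine IntegrableOn.mono_set ?_ hR
    rw [Real.closedBall_eq_Icc]
    rcases le_or_gt (0 - R) (0 + R) with hle | hlt
    · rw [integrableOn_Icc_iff_integrableOn_Ioc, ← intervalIntegrable_iff_integrableOn_Ioc_of_le hle]
      exact intervalIntegral.intervalIntegrable_log'
    · rw [Set.Icc_eq_empty (not_le.mpr hlt)]
      exact integrableOn_empty
  have := hl.integrable_smul_right_of_hasCompactSupport (h.contDiff.continuous.pow 2)
    h.hasCompactSupport_sq
  simpa using this

/-- Near zero the polar part contributes only `O(X⁻²)`. -/
theorem exists_abs_integral_sub_le (h : MellinTest Φ) (γ : ℝ) :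
    ∃ K : ℝ, ∀ X : ℝ, 1 ≤ X →
      |-(∫ x in Set.Ioi (1 / X), (2 * Real.log (X * x) - 2 * γ) * (4 * π ^ 2 * Φ x ^ 2)) -
        (-2 * CPhi Φ * Real.log X - 2 * CPhi' Φ + 2 * γ * CPhi Φ)| ≤ K * X ^ (-(2 : ℝ) / 5) := by
  obtain ⟨C, R, hC, hR, hb, h0⟩ := h.exists_bound
  refine ⟨(2 + 2 * |γ|) * (4 * π ^ 2 * C ^ 2), fun X hX => ?_⟩
  have hX0 : 0 < X := by linarith
  have hi1 := h.integrable_sq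
  have hi2 := h.integrable_log_mul_sq
  set f : ℝ → ℝ := fun x => (2 * Real.log (X * x) - 2 * γ) * (4 * π ^ 2 * Φ x ^ 2) with hf
  have hfe : ∀ x ∈ Set.Ioi (0 : ℝ), f x =
      (2 * Real.log X - 2 * γ) * (4 * π ^ 2) * (Φ x ^ 2) +
        2 * (4 * π ^ 2) * (Real.log x * Φ x ^ 2) := by
    intro x hx
    rw [hf]
    simp only
    rw [Real.log_mul hX0.ne' (ne_of_gt hx)]
    ring
  have hfi : IntegrableOn f (Set.Ioi 0) := by
    refine IntegrableOn.congr_fun ?_ (fun x hx => (hfe x hx).symm) measurableSet_Ioi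
    exact ((hi1.const_mul _).add (hi2.const_mul _)).integrableOn
  have htot : ∫ x in Set.Ioi 0, f x =
      2 * CPhi Φ * Real.log X + 2 * CPhi' Φ - 2 * γ * CPhi Φ := by
    rw [setIntegral_congr_fun measurableSet_Ioi hfe,
      integral_add (hi1.const_mul _).integrableOn (hi2.const_mul _).integrableOn,
      integral_const_mul, integral_const_mul, CPhi, CPhi']
    ring
  have hsplit : ∫ x in Set.Ioi 0, f x =
      (∫ x in Set.Ioc 0 (1 / X), f x) + ∫ x in Set.Ioi (1 / X), f x := by
    rw [← setIntegral_union (Set.Ioc_disjoint_Ioi le_rfl) measurableSet_Ioi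
      (hfi.mono_set Set.Ioc_subset_Ioi_self)
      (hfi.mono_set (Set.Ioi_subset_Ioi (by positivity))),
      Set.Ioc_union_Ioi_eq_Ioi (by positivity)]
  have hsmall : ‖∫ x in Set.Ioc 0 (1 / X), f x‖ ≤
      (2 + 2 * |γ|) * (4 * π ^ 2 * C ^ 2) * X⁻¹ * volume.real (Set.Ioc 0 (1 / X)) := by
    refine norm_setIntegral_le_of_norm_le_const (by simp) fun x hx => ?_
    have hx0 : 0 < x := hx.1
    have hXx : X * x ≤ 1 := by
      have := hx.2
      rwa [le_div_iff₀ hX0, mul_comm] at this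
    have hXx0 : 0 < X * x := by positivity
    have hl : |Real.log (X * x)| * (X * x) ≤ 1 := by
      have := (Real.abs_log_mul_self_lt (X * x) hXx0 hXx).le
      rwa [abs_mul, abs_of_pos hXx0] at this
    have hΦ : Φ x ^ 2 ≤ (C * x) ^ 2 := by
      have := hb x
      rw [abs_of_pos hx0] at this
      rw [← sq_abs]
      gcongr
    have hxX : x ≤ X⁻¹ := by simpa using hx.2
    have hx1 : x ≤ 1 := hxX.trans (inv_le_one_of_one_le₀ hX)
    rw [hf, norm_mul, Real.norm_eq_abs, Real.norm_of_nonneg (by positivity)]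
    have ht : |2 * Real.log (X * x) - 2 * γ| ≤ 2 * |Real.log (X * x)| + 2 * |γ| := by
      refine (abs_sub _ _).trans (le_of_eq ?_)
      simp [abs_mul]
    have hlx : |Real.log (X * x)| * x ≤ X⁻¹ := by
      rw [← one_div, le_div_iff₀ hX0]
      linarith
    calc _ ≤ (2 * |Real.log (X * x)| + 2 * |γ|) * (4 * π ^ 2 * (C * x) ^ 2) := by gcongr
      _ = (2 * (|Real.log (X * x)| * x) + 2 * |γ| * x) * (4 * π ^ 2 * C ^ 2) * x := by ring
      _ ≤ (2 * X⁻¹ + 2 * |γ| * X⁻¹) * (4 * π ^ 2 * C ^ 2) * 1 := by gcongr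
      _ = _ := by ring
  have hvol : volume.real (Set.Ioc 0 (1 / X)) ≤ 1 := by
    rw [Real.volume_real_Ioc_of_le (by positivity), sub_zero, one_div]
    exact inv_le_one_of_one_le₀ hX
  have hpow : X⁻¹ ≤ X ^ (-(2 : ℝ) / 5) := by
    rw [← Real.rpow_neg_one]
    exact Real.rpow_le_rpow_of_exponent_le hX (by norm_num)
  have e : -(∫ x in Set.Ioi (1 / X), f x) -
      (-2 * CPhi Φ * Real.log X - 2 * CPhi' Φ + 2 * γ * CPhi Φ) =
      ∫ x in Set.Ioc 0 (1 / X), f x := by linarith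
  rw [e, ← Real.norm_eq_abs]
  calc _ ≤ _ := hsmall
    _ ≤ (2 + 2 * |γ|) * (4 * π ^ 2 * C ^ 2) * X ^ (-(2 : ℝ) / 5) * 1 := by gcongr
    _ = _ := mul_one _

end MellinTest

/-- Shifting a vertical line of integration inside a strip of holomorphy with quadratic decay. -/
theorem integral_vertical_eq_of_norm_le {F : ℂ → ℂ} {a b C : ℝ} (hab : a ≤ b)
    (hF : DifferentiableOn ℂ F {s | a ≤ s.re ∧ s.re ≤ b})
    (hC : ∀ s : ℂ, a ≤ s.re → s.re ≤ b → ‖F s‖ ≤ C * (1 + s.im ^ 2)⁻¹) :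
    ∫ t : ℝ, F (a + t * Complex.I) = ∫ t : ℝ, F (b + t * Complex.I) := by
  have hint : ∀ σ : ℝ, a ≤ σ → σ ≤ b → Integrable fun t : ℝ => F (σ + t * Complex.I) := by
    intro σ h1 h2
    refine (integrable_inv_one_add_sq.const_mul C).mono' ?_ (Eventually.of_forall fun t => ?_)
    · refine Continuous.aestronglyMeasurable ?_
      exact hF.continuousOn.comp_continuous (by fun_prop) fun t => by simp [h1, h2]
    · simpa using hC (σ + t * Complex.I) (by simpa using h1) (by simpa using h2)
  have hlim : ∀ σ : ℝ, a ≤ σ → σ ≤ b → Tendsto (fun T : ℝ => ∫ t in (-T)..T,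
      F (σ + t * Complex.I)) atTop (nhds (∫ t : ℝ, F (σ + t * Complex.I))) := fun σ h1 h2 =>
    intervalIntegral_tendsto_integral (hint σ h1 h2) tendsto_neg_atTop_atBot tendsto_id
  have hinv : Tendsto (fun T : ℝ => C * (1 + T ^ 2)⁻¹ * |b - a|) atTop (nhds 0) := by
    have h1 : Tendsto (fun T : ℝ => 1 + T ^ 2) atTop atTop :=
      tendsto_atTop_add_const_left _ _ (tendsto_pow_atTop (by norm_num))
    simpa using (h1.inv_tendsto_atTop.const_mul C).mul_const |b - a|
  have hhor : ∀ s : ℝ, s ^ 2 = 1 → Tendsto (fun T : ℝ => ∫ x in a..b,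
      F (x + ((s * T : ℝ) : ℂ) * Complex.I)) atTop (nhds 0) := by
    intro s hs
    refine squeeze_zero_norm (fun T => ?_) hinv
    refine intervalIntegral.norm_integral_le_of_norm_le_const fun x hx => ?_
    rw [Set.uIoc_of_le hab] at hx
    have := hC (x + ((s * T : ℝ) : ℂ) * Complex.I) (by simpa using hx.1.le) (by simpa using hx.2)
    simpa [mul_pow, hs] using this
  have hrect : ∀ T : ℝ, (∫ x in a..b, F (x + ((-1 * T : ℝ) : ℂ) * Complex.I)) -
      (∫ x in a..b, F (x + ((1 * T : ℝ) : ℂ) * Complex.I)) +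
      Complex.I * (∫ t in (-T)..T, F (b + t * Complex.I)) -
      Complex.I * (∫ t in (-T)..T, F (a + t * Complex.I)) = 0 := by
    intro T
    have := Complex.integral_boundary_rect_eq_zero_of_differentiableOn F
      (a + ((-1 * T : ℝ) : ℂ) * Complex.I) (b + ((1 * T : ℝ) : ℂ) * Complex.I) (hF.mono ?_)
    · simpa using this
    · intro s hs
      have := hs.1
      simp only [Set.mem_preimage] at this
      rw [Set.uIcc_of_le (by simpa using hab)] at this
      simpa using this
  have hz := (((hhor (-1) (by norm_num)).sub (hhor 1 (by norm_num))).add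
    ((hlim b hab le_rfl).const_mul Complex.I)).sub ((hlim a le_rfl hab).const_mul Complex.I)
  have h0 := tendsto_nhds_unique (hz.congr hrect) tendsto_const_nhds
  rw [sub_self, zero_add, sub_eq_zero] at h0
  exact (mul_left_cancel₀ Complex.I_ne_zero h0).symm

theorem one_add_add_sq_le (t u : ℝ) : 1 + (t + u) ^ 2 ≤ 2 * (1 + t ^ 2) * (1 + u ^ 2) := by
  nlinarith [sq_nonneg (t - u), sq_nonneg (t * u)]

/-- The integrand with `ζ''/ζ` replaced by its regular part. -/
def regularIntegrand (Φ : ℝ → ℝ) (X : ℝ) (α β : ℂ) : ℂ :=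
  zetaH (1 + α + β) * mellinC Φ (1 / 2 + α) * mellinC Φ (1 / 2 + β) * (X : ℂ) ^ (α + β)

namespace MellinTest

variable {Φ : ℝ → ℝ}

theorem exists_norm_regularIntegrand_le (h : MellinTest Φ)
    (hRH : ∀ s : ℂ, 0 < s.re → s.re < 1 → riemannZeta s = 0 → s.re = 1 / 2) :
    ∃ D : ℝ, 0 < D ∧ ∀ (X : ℝ) (α β : ℂ), 0 < X → -1 ≤ α.re → α.re ≤ 1 / 2 → -1 ≤ β.re →
      β.re ≤ 1 / 2 → -(2 / 5) ≤ α.re + β.re → α.re + β.re ≤ 1 / 2 →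
      ‖regularIntegrand Φ X α β‖ ≤
        D * X ^ (α.re + β.re) * (1 + β.im ^ 2)⁻¹ * (1 + α.im ^ 2)⁻¹ := by
  obtain ⟨C, hC, hc⟩ := exists_norm_zetaH_le hRH
  obtain ⟨B, hB, hb⟩ := h.exists_norm_mellinC_le_inv
  refine ⟨2 * C * B * B, by positivity, fun X α β hX h1 h2 h3 h4 h5 h6 => ?_⟩
  have e1 := hc (1 + α + β) (by simp; linarith) (by simp; linarith)
  have e2 := hb (1 / 2 + α) (by simp; linarith) (by simp; linarith)
  have e3 := hb (1 / 2 + β) (by simp; linarith) (by simp; linarith)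
  have i1 : (1 + α + β).im = α.im + β.im := by simp
  have i2 : (1 / 2 + α).im = α.im := by simp
  have i3 : (1 / 2 + β).im = β.im := by simp
  rw [i1] at e1
  rw [i2] at e2
  rw [i3] at e3
  have e4 := one_add_add_sq_le α.im β.im
  have ht : 1 + α.im ^ 2 ≠ 0 := by positivity
  have hu : 1 + β.im ^ 2 ≠ 0 := by positivity
  rw [regularIntegrand, norm_mul, norm_mul, norm_mul, Complex.norm_cpow_eq_rpow_re_of_pos hX,
    Complex.add_re]
  calc _ ≤ (C * (2 * (1 + α.im ^ 2) * (1 + β.im ^ 2))) *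
        (B * ((1 + α.im ^ 2)⁻¹ * (1 + α.im ^ 2)⁻¹)) *
        (B * ((1 + β.im ^ 2)⁻¹ * (1 + β.im ^ 2)⁻¹)) * X ^ (α.re + β.re) := by
        gcongr
        exact e1.trans (by gcongr)
    _ = _ := by field_simp

theorem differentiableAt_regularIntegrand (h : MellinTest Φ)
    (hRH : ∀ s : ℂ, 0 < s.re → s.re < 1 → riemannZeta s = 0 → s.re = 1 / 2) {X : ℝ} (hX : 0 < X)
    {α β : ℂ} (hα : -1 ≤ α.re) (hαβ : -(2 / 5) ≤ α.re + β.re) :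
    DifferentiableAt ℂ (fun α => regularIntegrand Φ X α β) α := by
  have hX0 : (X : ℂ) ≠ 0 := by exact_mod_cast hX.ne'
  have h1 : DifferentiableAt ℂ zetaH (1 + α + β) :=
    (differentiableOn_zetaH hRH).differentiableAt
      (isOpen_half_lt_re.mem_nhds (by simp; linarith))
  have h2 : DifferentiableAt ℂ (mellinC Φ) (1 / 2 + α) :=
    h.differentiableAt_mellinC (by simp; linarith)
  have h3 : DifferentiableAt ℂ (fun α : ℂ => zetaH (1 + α + β)) α :=
    h1.comp (f := fun α : ℂ => 1 + α + β) α (by fun_prop)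
  have h4 : DifferentiableAt ℂ (fun α : ℂ => mellinC Φ (1 / 2 + α)) α :=
    h2.comp (f := fun α : ℂ => 1 / 2 + α) α (by fun_prop)
  have h5 : DifferentiableAt ℂ (fun α : ℂ => (X : ℂ) ^ (α + β)) α :=
    DifferentiableAt.const_cpow (by fun_prop) (Or.inl hX0)
  exact ((h3.mul h4).mul_const _).mul h5

theorem continuous_regularIntegrand (h : MellinTest Φ)
    (hRH : ∀ s : ℂ, 0 < s.re → s.re < 1 → riemannZeta s = 0 → s.re = 1 / 2) {X : ℝ} (hX : 0 < X)
    {a b : ℝ} (ha : 0 < a) (hb : 0 < b) :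
    Continuous fun p : ℝ × ℝ =>
      regularIntegrand Φ X (a + p.2 * Complex.I) (b + p.1 * Complex.I) := by
  have hX0 : (X : ℂ) ≠ 0 := by exact_mod_cast hX.ne'
  have h1 : Continuous fun p : ℝ × ℝ =>
      zetaH (1 + (a + p.2 * Complex.I) + (b + p.1 * Complex.I)) :=
    (differentiableOn_zetaH hRH).continuousOn.comp_continuous (by fun_prop)
      fun p => by simp; linarith
  have hM : ∀ c : ℝ, 0 < c → Continuous fun t : ℝ => mellinC Φ (1 / 2 + (c + t * Complex.I)) := by
    intro c hc
    simpa only [add_assoc] using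
      h.continuous_mellinC_vertical (σ := 1 / 2 + c) (by simp; linarith)
  exact ((h1.mul ((hM a ha).comp continuous_snd)).mul ((hM b hb).comp continuous_fst)).mul
    (Continuous.const_cpow (by fun_prop) (Or.inl hX0))

theorem integrable_regularIntegrand (h : MellinTest Φ)
    (hRH : ∀ s : ℂ, 0 < s.re → s.re < 1 → riemannZeta s = 0 → s.re = 1 / 2) {X : ℝ} (hX : 0 < X)
    {a b : ℝ} (ha : 0 < a) (ha2 : a ≤ 1 / 4) (hb : 0 < b) (hb2 : b ≤ 1 / 4) :
    Integrable fun p : ℝ × ℝ =>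
      regularIntegrand Φ X (a + p.2 * Complex.I) (b + p.1 * Complex.I) := by
  obtain ⟨D, hD, hd⟩ := h.exists_norm_regularIntegrand_le hRH
  have hi := (integrable_inv_one_add_sq.mul_prod integrable_inv_one_add_sq).const_mul
    (D * X ^ (a + b))
  refine hi.mono' (h.continuous_regularIntegrand hRH hX ha hb).aestronglyMeasurable
    (Eventually.of_forall fun p => ?_)
  have := hd X (a + p.2 * Complex.I) (b + p.1 * Complex.I) hX (by simp; linarith)
    (by simp; linarith) (by simp; linarith) (by simp; linarith) (by simp; linarith)
    (by simp; linarith)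
  simpa [mul_assoc] using this

theorem exists_norm_integral_regularIntegrand_le (h : MellinTest Φ)
    (hRH : ∀ s : ℂ, 0 < s.re → s.re < 1 → riemannZeta s = 0 → s.re = 1 / 2)
    {a b : ℝ} (ha : 0 < a) (ha2 : a ≤ 1 / 4) (hb : 0 < b) (hb2 : b ≤ 1 / 4) :
    ∃ K : ℝ, ∀ X : ℝ, 0 < X →
      ‖∫ p : ℝ × ℝ, regularIntegrand Φ X (a + p.2 * Complex.I) (b + p.1 * Complex.I)‖ ≤
        K * X ^ (-(2 : ℝ) / 5) := by
  obtain ⟨D, hD, hd⟩ := h.exists_norm_regularIntegrand_le hRH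
  refine ⟨D * π * π, fun X hX => ?_⟩
  have hshift : ∀ u : ℝ, ‖∫ t : ℝ, regularIntegrand Φ X (a + t * Complex.I) (b + u * Complex.I)‖ ≤
      D * X ^ (-(2 : ℝ) / 5) * π * (1 + u ^ 2)⁻¹ := by
    intro u
    have hmove := integral_vertical_eq_of_norm_le
      (F := fun α => regularIntegrand Φ X α (b + u * Complex.I)) (a := -b - 2 / 5) (b := a)
      (C := D * (X ^ (-(2 : ℝ) / 5) + X ^ (a + b)) * (1 + u ^ 2)⁻¹) (by linarith)
      (fun s hs => (h.differentiableAt_regularIntegrand hRH hX (by linarith [hs.1])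
        (by simp; linarith [hs.1])).differentiableWithinAt)
      (fun s hs1 hs2 => ?_)
    · rw [← hmove]
      refine (norm_integral_le_of_norm_le
        (integrable_inv_one_add_sq.const_mul (D * X ^ (-(2 : ℝ) / 5) * (1 + u ^ 2)⁻¹))
        (Eventually.of_forall fun t => ?_)).trans (le_of_eq ?_)
      · have := hd X (((-b - 2 / 5 : ℝ) : ℂ) + t * Complex.I) (b + u * Complex.I) hX
        simp only [Complex.add_re, Complex.ofReal_re, Complex.re_ofReal_mul, Complex.I_re, mul_zero,
          add_zero, Complex.add_im, Complex.ofReal_im, Complex.im_ofReal_mul, Complex.I_im, mul_one,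
          zero_add] at this
        have := this (by linarith) (by linarith) (by linarith) (by linarith) (by linarith)
          (by linarith)
        rwa [show -b - 2 / 5 + b = -(2 : ℝ) / 5 by ring] at this
      · rw [integral_const_mul, integral_univ_inv_one_add_sq]
        ring
    · have := hd X s (b + u * Complex.I) hX
      simp only [Complex.add_re, Complex.ofReal_re, Complex.re_ofReal_mul, Complex.I_re, mul_zero,
        add_zero, Complex.add_im, Complex.ofReal_im, Complex.im_ofReal_mul, Complex.I_im, mul_one,
        zero_add] at this
      refine (this (by linarith) (by linarith) (by linarith) (by linarith) (by linarith)
        (by linarith)).trans ?_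
      have hXle : X ^ (s.re + b) ≤ X ^ (-(2 : ℝ) / 5) + X ^ (a + b) := by
        have p1 : 0 < X ^ (-(2 : ℝ) / 5) := by positivity
        have p2 : 0 < X ^ (a + b) := by positivity
        rcases le_total 1 X with hX1 | hX1
        · have := Real.rpow_le_rpow_of_exponent_le hX1 (by linarith : s.re + b ≤ a + b)
          linarith
        · have := Real.rpow_le_rpow_of_exponent_ge hX hX1
            (by linarith : -(2 : ℝ) / 5 ≤ s.re + b)
          linarith
      gcongr
  have hi := h.integrable_regularIntegrand hRH hX ha ha2 hb hb2
  rw [Measure.volume_eq_prod] at hi ⊢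
  rw [integral_prod _ hi]
  refine (norm_integral_le_of_norm_le
    (integrable_inv_one_add_sq.const_mul (D * X ^ (-(2 : ℝ) / 5) * π))
    (Eventually.of_forall hshift)).trans (le_of_eq ?_)
  rw [integral_const_mul, integral_univ_inv_one_add_sq]
  ring

end MellinTest

theorem vertInt_vertInt_eq {F : ℂ → ℂ → ℂ} {a b : ℝ}
    (hF : Integrable fun p : ℝ × ℝ => F (a + p.2 * Complex.I) (b + p.1 * Complex.I)) :
    vertInt (fun β => vertInt (fun α => F α β) a) b =
      -∫ p : ℝ × ℝ, F (a + p.2 * Complex.I) (b + p.1 * Complex.I) := by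
  rw [Measure.volume_eq_prod] at hF ⊢
  rw [integral_prod _ hF]
  simp only [vertInt]
  rw [integral_const_mul, ← mul_assoc, Complex.I_mul_I, neg_one_mul]

/-- The integral of `(ζ''/ζ)(1+α+β)` against `Φ̃(1/2+α) Φ̃(1/2+β) X^(α+β)` over two
vertical lines: `I = -2 C_Φ log X - 2 C'_Φ + 2 γ₀ C_Φ + O(X^{-2/5})`. -/
theorem zeta_second_log_deriv_integral
    (hRH : ∀ s : ℂ, 0 < s.re → s.re < 1 → riemannZeta s = 0 → s.re = 1 / 2)
    (Φ : ℝ → ℝ) (hΦ : ContDiff ℝ (⊤ : ℕ∞) Φ) (hΦc : HasCompactSupport Φ)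
    (hΦsupp : Function.support Φ ⊆ Set.Ioi 0)
    (ε ε' : ℝ) (hε : ε ∈ Set.Ioo (0:ℝ) (1/4)) (hε' : ε' ∈ Set.Ioo (0:ℝ) (1/4)) :
    (fun X : ℝ =>
        vertInt
            (fun β =>
              vertInt
                (fun α =>
                  deriv (deriv riemannZeta) (1 + α + β) / riemannZeta (1 + α + β) *
                      mellinC Φ (1 / 2 + α) * mellinC Φ (1 / 2 + β) * (X : ℂ) ^ (α + β))
                ε)
            ε' -
          ((-2 * CPhi Φ * Real.log X - 2 * CPhi' Φ +
              2 * Real.eulerMascheroniConstant * CPhi Φ : ℝ) : ℂ))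
      =O[atTop] (fun X : ℝ => X ^ (-(2 : ℝ) / 5)) := by
  have h : MellinTest Φ := ⟨hΦ, hΦc, hΦsupp⟩
  obtain ⟨K₁, hK₁⟩ := h.exists_norm_integral_regularIntegrand_le hRH hε.1 hε.2.le hε'.1 hε'.2.le
  obtain ⟨K₂, hK₂⟩ := h.exists_abs_integral_sub_le Real.eulerMascheroniConstant
  refine IsBigO.of_bound (K₁ + K₂) ?_
  filter_upwards [eventually_ge_atTop 1] with X hX
  have hX0 : 0 < X := by linarith
  have hsplit : ∀ p : ℝ × ℝ,
      deriv (deriv riemannZeta) (1 + (ε + p.2 * Complex.I) + (ε' + p.1 * Complex.I)) /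
          riemannZeta (1 + (ε + p.2 * Complex.I) + (ε' + p.1 * Complex.I)) *
          mellinC Φ (1 / 2 + (ε + p.2 * Complex.I)) * mellinC Φ (1 / 2 + (ε' + p.1 * Complex.I)) *
          (X : ℂ) ^ ((ε + p.2 * Complex.I) + (ε' + p.1 * Complex.I)) =
        regularIntegrand Φ X (ε + p.2 * Complex.I) (ε' + p.1 * Complex.I) +
        (2 / ((ε + p.2 * Complex.I) + (ε' + p.1 * Complex.I)) ^ 2 -
          ((2 * Real.eulerMascheroniConstant : ℝ) : ℂ) /
            ((ε + p.2 * Complex.I) + (ε' + p.1 * Complex.I))) *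
        mellinC Φ (1 / 2 + (ε + p.2 * Complex.I)) * mellinC Φ (1 / 2 + (ε' + p.1 * Complex.I)) *
        (X : ℂ) ^ ((ε + p.2 * Complex.I) + (ε' + p.1 * Complex.I)) := by
    intro p
    have hre : 1 < (1 + (ε + p.2 * Complex.I) + (ε' + p.1 * Complex.I)).re := by
      simp
      linarith [hε.1, hε'.1]
    have hne : 1 + (ε + p.2 * Complex.I) + (ε' + p.1 * Complex.I) ≠ 1 := by
      intro heq
      rw [heq, Complex.one_re] at hre
      exact lt_irrefl _ hre
    have hs : 1 + (ε + p.2 * Complex.I) + (ε' + p.1 * Complex.I) - 1 =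
        (ε + p.2 * Complex.I) + (ε' + p.1 * Complex.I) := by ring
    rw [deriv_deriv_riemannZeta_div hRH (by linarith) hne, hs, regularIntegrand]
    push_cast
    ring
  have hi1 := h.integrable_regularIntegrand hRH hX0 hε.1 hε.2.le hε'.1 hε'.2.le
  have hi2 := h.integrable_polar (2 * Real.eulerMascheroniConstant) hε.1 (by linarith [hε.2])
    hε'.1 (by linarith [hε'.2]) hX0
  have hv := vertInt_vertInt_eq (F := fun α β =>
    deriv (deriv riemannZeta) (1 + α + β) / riemannZeta (1 + α + β) *
      mellinC Φ (1 / 2 + α) * mellinC Φ (1 / 2 + β) * (X : ℂ) ^ (α + β)) (a := ε) (b := ε')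
    (by simp only [hsplit]; exact hi1.add hi2)
  rw [hv]
  simp only [hsplit]
  rw [integral_add hi1 hi2, h.integral_polar (2 * Real.eulerMascheroniConstant) hε.1
    (by linarith [hε.2]) hε'.1 (by linarith [hε'.2]) hX0]
  have e2 := hK₂ X hX
  rw [← Real.norm_eq_abs, ← Complex.norm_real] at e2
  have e1 := hK₁ X hX0
  rw [← norm_neg] at e1
  rw [Real.norm_of_nonneg (by positivity : 0 ≤ X ^ (-(2 : ℝ) / 5)), add_mul]
  refine le_trans (le_of_eq ?_) ((norm_add_le _ _).trans (add_le_add e1 e2))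
  congr 1
  push_cast
  ring
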